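/- arXiv:2207.03759 — 2 statements merged into one kernel-verified Lean document; each statement's English description precedes it below -/
import Mathlib

section
/- Let F' = k(t, y) be the function field of the curve y^(q+1) = t^q − 2·t^((q+1)/2) + t, and let ξ ∈ k satisfy ξ^((q−1)/2) = 1 (so ξ^q = ξ and ξ ≠ 0). Then F' is a finite Galois extension of the intermediate field k⟮y/(t − ξ)⟯ generated by k and y/(t − ξ), and Gal(F'/k⟮y/(t − ξ)⟯) is isomorphic to the dihedral group of order q−1. -/
open IntermediateField Polynomial

section Dihedral

variable {G : Type*} [Group G] {m : ℕ} {ρ σ : G}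

theorem DihedralGroup.exists_monoidHom (hρ : ρ ^ m = 1) (hσ : σ * σ = 1)
    (hρσ : ρ * σ = σ * ρ⁻¹) :
    ∃ φ : DihedralGroup m →* G,
      (∀ j : ℤ, φ (.r j) = ρ ^ j) ∧ ∀ j : ℤ, φ (.sr j) = σ * ρ ^ j := by
  have hcast (i : ZMod m) : ∃ j : ℤ, (j : ZMod m) = i := ZMod.intCast_surjective i
  have hconj (a : ℤ) : ρ ^ a * σ = σ * ρ ^ (-a) := by
    have h : SemiconjBy σ ρ⁻¹ ρ := hρσ.symm
    have := (h.zpow_right a).eq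
    rw [inv_zpow'] at this
    exact this.symm
  let f : ZMod m →+ Additive G := ZMod.lift m ⟨zmultiplesHom _ (Additive.ofMul ρ), by
    rw [zmultiplesHom_apply, natCast_zsmul, ← ofMul_pow, hρ, ofMul_one]⟩
  have hf (a : ℤ) : (f a).toMul = ρ ^ a := by
    simp [f]
  let g : DihedralGroup m → G
    | .r i => (f i).toMul
    | .sr i => σ * (f i).toMul
  refine ⟨MonoidHom.mk' g ?_, hf, fun j => congrArg (σ * ·) (hf j)⟩
  rintro (i | i) (j | j) <;> obtain ⟨a, rfl⟩ := hcast i <;> obtain ⟨b, rfl⟩ := hcast j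
  · simp only [DihedralGroup.r_mul_r, g, ← Int.cast_add, hf, zpow_add]
  · simp only [DihedralGroup.r_mul_sr, g, ← Int.cast_sub, hf]
    rw [← mul_assoc, hconj, mul_assoc, ← zpow_add, neg_add_eq_sub]
  · simp only [DihedralGroup.sr_mul_r, g, ← Int.cast_add, hf, zpow_add, mul_assoc]
  · simp only [DihedralGroup.sr_mul_sr, g, ← Int.cast_sub, hf]
    rw [mul_assoc, ← mul_assoc _ σ, hconj, mul_assoc, ← mul_assoc σ, hσ, one_mul, ← zpow_add,
      neg_add_eq_sub]

end Dihedral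

theorem exists_algEquiv_apply_eq_of_adjoin_simple_eq_top {K L : Type*} [Field K] [Field L]
    [Algebra K L] [FiniteDimensional K L] {x x' : L} (htop : K⟮x⟯ = ⊤)
    (hx' : aeval x' (minpoly K x) = 0) : ∃ σ : L ≃ₐ[K] L, σ x = x' := by
  have hx : IsIntegral K x := Algebra.IsIntegral.isIntegral x
  let τ : K⟮x⟯ →ₐ[K] L := (algHomAdjoinIntegralEquiv K hx).symm
    ⟨x', (mem_aroots.2 ⟨minpoly.ne_zero hx, hx'⟩)⟩
  let e : L →ₐ[K] L := τ.comp ((equivOfEq htop).trans topEquiv).symm.toAlgHom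
  refine ⟨AlgEquiv.ofBijective e (Algebra.IsAlgebraic.algHom_bijective e), ?_⟩
  exact algHomAdjoinIntegralEquiv_symm_apply_gen K hx _

theorem irreducible_C_mul_X_pow_add_C {R : Type*} [CommRing R] [IsDomain R] {A B π : R} {e : ℕ}
    (he : e ≠ 0) (hπ : Prime π) (hA : ¬ π ∣ A) (hB : π ∣ B) (hB2 : ¬ π ^ 2 ∣ B)
    (hAB : IsRelPrime A B) : Irreducible (C A * X ^ e + C B) := by
  have hA0 : A ≠ 0 := fun h => hA (h ▸ dvd_zero π)
  have hcoeff0 : (C A * X ^ e + C B).coeff 0 = B := by simp [coeff_X_pow, he.symm]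
  have hcoeffe : (C A * X ^ e + C B).coeff e = A := by simp [coeff_C, he]
  have hdeg : (C A * X ^ e + C B).degree = (e : WithBot ℕ) := by
    compute_degree!
    simpa [he] using hA0
  refine irreducible_of_eisenstein_criterion (P := Ideal.span {π})
    ((Ideal.span_singleton_prime hπ.ne_zero).2 hπ) ?_ ?_ ?_ ?_ ?_
  · rwa [leadingCoeff, natDegree_eq_of_degree_eq_some hdeg, hcoeffe, Ideal.mem_span_singleton]
  · intro i hi
    rw [hdeg, Nat.cast_lt] at hi
    rw [Ideal.mem_span_singleton]
    rcases eq_or_ne i 0 with rfl | hi0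
    · rwa [hcoeff0]
    · simp [coeff_X_pow, coeff_C, hi.ne, hi0]
  · rw [hdeg]
    exact_mod_cast he.bot_lt
  · rwa [hcoeff0, Ideal.span_singleton_pow, Ideal.mem_span_singleton]
  · intro r hr
    rw [C_dvd_iff_dvd_coeff] at hr
    exact hAB (hcoeffe ▸ hr e) (hcoeff0 ▸ hr 0)

theorem degree_C_mul_X_pow_add_one_lt {R : Type*} [CommRing R] [Nontrivial R] {m : ℕ} (hm : m ≠ 0)
    (a : R) : (C a * X ^ m + 1).degree < (X ^ (2 * m) : R[X]).degree := by
  have h : (C a * X ^ m + 1).degree ≤ (m : WithBot ℕ) := by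
    compute_degree
    exact le_rfl
  rw [degree_X_pow]
  exact h.trans_lt (by exact_mod_cast (by omega : m < 2 * m))

theorem monic_X_pow_two_mul_sub {R : Type*} [CommRing R] [Nontrivial R] {m : ℕ} (hm : m ≠ 0)
    (a : R) : (X ^ (2 * m) - (C a * X ^ m + 1)).Monic :=
  (monic_X_pow _).sub_of_left (degree_C_mul_X_pow_add_one_lt hm a)

theorem natDegree_X_pow_two_mul_sub {R : Type*} [CommRing R] [Nontrivial R] {m : ℕ} (hm : m ≠ 0)
    (a : R) : (X ^ (2 * m) - (C a * X ^ m + 1)).natDegree = 2 * m := by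
  rw [natDegree_eq_of_degree_eq (degree_sub_eq_left_of_degree_lt
    (degree_C_mul_X_pow_add_one_lt hm a)), natDegree_X_pow]

section Irreducible

variable {k : Type*} [Field k] {m e : ℕ} {c : k}

/-- The polynomial `W ^ (2 m) - c U ^ e W ^ m - 1` in the variable `W` over `k[U]`. -/
noncomputable def dihedralPoly (m e : ℕ) (c : k) : k[X][X] :=
  X ^ (2 * m) - (C (C c * X ^ e) * X ^ m + 1)

/-- Seen as a polynomial in `U` over `k[W]`, it is Eisenstein at `W - 1`. -/
theorem dihedralPoly_irreducible (hm : ((2 * m : ℕ) : k) ≠ 0) (he : e ≠ 0) (hc : c ≠ 0) :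
    Irreducible (dihedralPoly m e c) := by
  have hm0 : 2 * m ≠ 0 := fun h => hm (by simp [h])
  have hprime : Prime (X - C 1 : k[X]) := prime_X_sub_C 1
  have hsep : (X ^ (2 * m) - 1 : k[X]).Separable := X_pow_sub_one_separable_iff.2 hm
  have hswap : Bivariate.swap (dihedralPoly m e c) =
      C (-(C c * X ^ m)) * X ^ e + C (X ^ (2 * m) - 1) := by
    simp only [dihedralPoly, map_sub, map_add, map_mul, map_pow, map_one, map_neg,
      Bivariate.swap_X, Bivariate.swap_Y, Bivariate.swap_C_C]
    ring
  rw [← MulEquiv.irreducible_iff (Bivariate.swap (R := k)), hswap]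
  refine irreducible_C_mul_X_pow_add_C he hprime ?_ ?_ ?_ ?_
  · rw [dvd_iff_isRoot]
    simp [hc]
  · rw [dvd_iff_isRoot]
    simp
  · rw [sq]
    exact fun h => hprime.not_isUnit (hsep.squarefree _ h)
  · intro r hA hB
    rw [dvd_neg, (isUnit_C.2 hc.isUnit).dvd_mul_left] at hA
    have h1 : r ∣ X ^ (2 * m) := hA.trans (pow_dvd_pow _ (by omega))
    exact isUnit_of_dvd_one ((dvd_sub_right h1).1 hB)

end Irreducible

section FunctionField

variable {k F : Type*} [Field k] [Field F] [Algebra k F] {m e : ℕ} {c : k} {u w : F}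

/-- The minimal polynomial of `w` over `k(u)` is `W ^ (2 m) - c u ^ e W ^ m - 1`. -/
theorem minpoly_eq_of_pow_sub_one_eq (hm : ((2 * m : ℕ) : k) ≠ 0) (he : e ≠ 0) (hc : c ≠ 0)
    (hu : Transcendental k u)
    (h : w ^ (2 * m) - 1 = algebraMap k F c * u ^ e * w ^ m) :
    minpoly k⟮u⟯ w = X ^ (2 * m) -
      (C (algebraMap k k⟮u⟯ c * AdjoinSimple.gen k u ^ e) * X ^ m + 1) := by
  have hm0 : m ≠ 0 := by rintro rfl; simp at hm
  let E := RatFunc.algEquivOfTranscendental u hu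
  have hmonic : (dihedralPoly m e c).Monic := monic_X_pow_two_mul_sub hm0 _
  have hirr := (hmonic.irreducible_iff_irreducible_map_fraction_map (K := RatFunc k)).1 (dihedralPoly_irreducible hm he hc)
  rw [← MulEquiv.irreducible_iff (mapEquiv E.toRingEquiv)] at hirr
  have hE : E RatFunc.X = AdjoinSimple.gen k u := 
    Subtype.ext (RatFunc.algEquivOfTranscendental_X u hu)
  have hmap : mapEquiv E.toRingEquiv ((dihedralPoly m e c).map (algebraMap k[X] (RatFunc k))) =
      X ^ (2 * m) - (C (algebraMap k k⟮u⟯ c * AdjoinSimple.gen k u ^ e) * X ^ m + 1) := by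
    have hC : E (RatFunc.C c) = algebraMap k k⟮u⟯ c := E.commutes c
    simp [dihedralPoly, mapEquiv_apply, hE, hC]
  replace hirr := hmap ▸ hirr
  refine (minpoly.eq_of_irreducible_of_monic hirr ?_ ?_).symm
  · simp
    linear_combination h
  · exact monic_X_pow_two_mul_sub hm0 _

/-- A Kummer-type criterion: a dihedral extension of `k(u)` is generated by `w` with
`w ^ m - w ^ (-m) = c * u ^ e`. -/
theorem isGalois_dihedral_of_pow_sub_one_eq [IsAlgClosed k] (hm : ((2 * m : ℕ) : k) ≠ 0)
    (he : e ≠ 0) (hc : c ≠ 0) (hw : Transcendental k w)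
    (h : w ^ (2 * m) - 1 = algebraMap k F c * u ^ e * w ^ m) (hgen : adjoin k {u, w} = ⊤) :
    FiniteDimensional k⟮u⟯ F ∧ IsGalois k⟮u⟯ F ∧
      Nonempty ((F ≃ₐ[k⟮u⟯] F) ≃* DihedralGroup m) := by
  have hm0 : m ≠ 0 := by rintro rfl; simp at hm
  have hmk : (m : k) ≠ 0 := by rintro h; simp [h] at hm
  have hw0 : w ≠ 0 := fun h0 => hw (h0 ▸ isAlgebraic_zero)
  have hu : Transcendental k u := by
    intro hu
    rw [← mem_algebraicClosure_iff,
      IntermediateField.eq_bot_of_isAlgClosed_of_isAlgebraic (algebraicClosure k F)] at hu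
    obtain ⟨d, rfl⟩ := mem_bot.1 hu
    refine hw ⟨X ^ (2 * m) - (C (c * d ^ e) * X ^ m + 1),
      (monic_X_pow_two_mul_sub hm0 _).ne_zero, ?_⟩
    simp only [map_sub, map_add, map_mul, map_pow, aeval_X, aeval_C, map_one]
    linear_combination h
  have hmin := minpoly_eq_of_pow_sub_one_eq hm he hc hu h
  have hint : IsIntegral k⟮u⟯ w := minpoly.ne_zero_iff.1 (by
    rw [hmin]; exact (monic_X_pow_two_mul_sub hm0 _).ne_zero)
  have htop : k⟮u⟯⟮w⟯ = ⊤ := by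
    apply restrictScalars_injective k
    rw [adjoin_simple_adjoin_simple, hgen, restrictScalars_top]
  have hfd : FiniteDimensional k⟮u⟯ F := by
    have := adjoin.finiteDimensional hint
    rw [htop] at this
    exact topEquiv.toLinearEquiv.finiteDimensional
  have hrank : Module.finrank k⟮u⟯ F = 2 * m := by
    rw [← finrank_top', ← htop, adjoin.finrank hint, hmin, natDegree_X_pow_two_mul_sub hm0]
  have hext {σ τ : F ≃ₐ[k⟮u⟯] F} (hστ : σ w = τ w) : σ = τ := by
    have : σ.toAlgHom.comp k⟮u⟯⟮w⟯.val = τ.toAlgHom.comp k⟮u⟯⟮w⟯.val :=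
      adjoin_algHom_ext _ (by simpa using hστ)
    exact AlgEquiv.ext fun z => DFunLike.congr_fun this ⟨z, htop ▸ mem_top⟩
  have hroot {w' : F} (h' : w' ^ (2 * m) - 1 = algebraMap k F c * u ^ e * w' ^ m) :
      ∃ σ : F ≃ₐ[k⟮u⟯] F, σ w = w' := by
    refine exists_algEquiv_apply_eq_of_adjoin_simple_eq_top htop ?_
    rw [hmin]
    simp only [map_sub, map_add, map_mul, map_pow, aeval_X, aeval_C, map_one,
      ← IsScalarTower.algebraMap_apply, AdjoinSimple.algebraMap_gen]
    linear_combination h'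
  have : NeZero (m : k) := ⟨hmk⟩
  obtain ⟨ζ, hζ⟩ := HasEnoughRootsOfUnity.exists_primitiveRoot k m
  obtain ⟨η, hη⟩ := IsAlgClosed.exists_pow_nat_eq (-1 : k) hm0.bot_lt
  have hη0 : η ≠ 0 := by rintro rfl; simp [hm0] at hη
  have hζ0 : ζ ≠ 0 := hζ.ne_zero hm0
  have hηF : algebraMap k F η ^ m = -1 := by rw [← map_pow, hη, map_neg, map_one]
  have hζF : algebraMap k F ζ ^ m = 1 := by rw [← map_pow, hζ.pow_eq_one, map_one]
  have hη0F : algebraMap k F η ≠ 0 := by simpa using hη0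
  have hζ0F : algebraMap k F ζ ≠ 0 := by simpa using hζ0
  obtain ⟨ρ, hρ⟩ := hroot (w' := algebraMap k F ζ * w) (by
    rw [mul_comm 2, pow_mul, mul_pow, hζF, one_mul, ← pow_mul, mul_comm m, h])
  obtain ⟨σ, hσ⟩ := hroot (w' := algebraMap k F η * w⁻¹) (by
    have : w ^ m ≠ 0 := pow_ne_zero m hw0
    rw [mul_comm 2, pow_mul, mul_pow, hηF, inv_pow]
    field_simp
    linear_combination - h)
  have hcomm (τ : F ≃ₐ[k⟮u⟯] F) (a : k) : τ (algebraMap k F a) = algebraMap k F a :=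
    (τ.restrictScalars k).commutes a
  have hρpow (j : ℤ) : (ρ ^ j) w = algebraMap k F (ζ ^ j) * w := by
    have hnat (i : ℕ) : (ρ ^ i) w = algebraMap k F (ζ ^ i) * w := by
      induction i with
      | zero => simp
      | succ i ih =>
        rw [pow_succ', AlgEquiv.mul_apply, ih, map_mul, hcomm, hρ, pow_succ, map_mul, mul_assoc]
    obtain ⟨i, rfl | rfl⟩ := j.eq_nat_or_neg
    · simpa using hnat i
    · apply (ρ ^ i).injective
      rw [← AlgEquiv.mul_apply, zpow_neg, zpow_natCast, mul_inv_cancel, AlgEquiv.one_apply,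
        map_mul, hcomm, hnat, ← mul_assoc, ← map_mul, zpow_neg, zpow_natCast,
        inv_mul_cancel₀ (pow_ne_zero i hζ0), map_one, one_mul]
  obtain ⟨φ, hr, hsr⟩ := DihedralGroup.exists_monoidHom (m := m) (ρ := ρ) (σ := σ)
    (by
      apply hext
      rw [← zpow_natCast, hρpow, zpow_natCast, hζ.pow_eq_one]
      simp)
    (by
      apply hext
      rw [AlgEquiv.mul_apply, hσ, map_mul, map_inv₀, hσ, hcomm, AlgEquiv.one_apply]
      field_simp)
    (by
      apply hext
      rw [← zpow_neg_one, AlgEquiv.mul_apply, AlgEquiv.mul_apply, hρpow, hσ, map_mul, map_mul,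
        map_inv₀, hρ, hσ, hcomm, hcomm, zpow_neg_one, map_inv₀]
      field_simp)
  have hinj : Function.Injective φ := by
    rw [injective_iff_map_eq_one]
    rintro (i | i) hi <;> obtain ⟨j, rfl⟩ := ZMod.intCast_surjective i
    · rw [hr] at hi
      have hj := hρpow j
      rw [hi, AlgEquiv.one_apply, right_eq_mul₀ hw0, map_eq_one_iff _ (algebraMap k F).injective,
        hζ.zpow_eq_one_iff_dvd, ← ZMod.intCast_zmod_eq_zero_iff_dvd] at hj
      rw [hj, DihedralGroup.r_zero]
    · rw [hsr] at hi
      have hj : (σ * ρ ^ j) w = w := by rw [hi, AlgEquiv.one_apply]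
      rw [AlgEquiv.mul_apply, hρpow, map_mul, hcomm, hσ, ← mul_assoc, ← map_mul,
        mul_inv_eq_iff_eq_mul₀ hw0] at hj
      exact absurd (isAlgebraic_algebraMap (R := k) (A := F) (ζ ^ j * η))
        (hj ▸ sq w ▸ hw.pow two_pos)
  have hcard : Nat.card (F ≃ₐ[k⟮u⟯] F) = 2 * m := by
    refine le_antisymm ?_ ?_
    · rw [← hrank, Nat.card_eq_fintype_card]
      exact AlgEquiv.card_le
    · rw [← DihedralGroup.nat_card]
      exact Nat.card_le_card_of_injective φ hinj
  have : NeZero m := ⟨hm0⟩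
  refine ⟨hfd, IsGalois.of_card_aut_eq_finrank _ _ (hcard.trans hrank.symm),
    ⟨(MulEquiv.ofBijective φ ?_).symm⟩⟩
  exact (Nat.bijective_iff_injective_and_card φ).2 ⟨hinj, by rw [hcard, DihedralGroup.nat_card]⟩

end FunctionField

/-- Let `F' = k(t, y)` be the function field of the curve
`y^(q+1) = t^q - 2 t^((q+1)/2) + t`, and let `ξ ∈ k` satisfy `ξ^((q-1)/2) = 1`.
Then `F'` is a finite Galois extension of `k⟮y/(t - ξ)⟯`, and its Galois group is
isomorphic to the dihedral group of order `q - 1`. -/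
theorem stmt_16
    (k : Type*) [Field k] [IsAlgClosed k]
    (p : ℕ) [Fact p.Prime] (hp2 : p ≠ 2) [CharP k p]
    (n q : ℕ) (hq : q = p ^ n) (hq5 : 5 ≤ q)
    (F' : Type*) [Field F'] [Algebra k F']
    (t y : F') (ht : Transcendental k t)
    (hty : y ^ (q + 1) = t ^ q - 2 * t ^ ((q + 1) / 2) + t)
    (hgen : adjoin k {t, y} = ⊤)
    (ξ : k) (hξ : ξ ^ ((q - 1) / 2) = 1)
    (u : F') (hu : u = y / (t - algebraMap k F' ξ)) :
    FiniteDimensional k⟮u⟯ F' ∧ IsGalois k⟮u⟯ F' ∧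
      Nonempty ((F' ≃ₐ[k⟮u⟯] F') ≃* DihedralGroup ((q - 1) / 2)) := by
  have hp : p.Prime := Fact.out
  have hn : n ≠ 0 := by rintro rfl; simp at hq; omega
  have hqodd : Odd q := hq ▸ (hp.odd_of_ne_two hp2).pow
  obtain ⟨m, hqm⟩ := hqodd
  have hm0 : m ≠ 0 := by omega
  have hqk : (q : k) = 0 := by rw [hq, Nat.cast_pow, CharP.cast_eq_zero, zero_pow hn]
  have h2mk : ((2 * m : ℕ) : k) = -1 := by
    rw [hqm, Nat.cast_add, Nat.cast_one] at hqk
    exact eq_neg_of_add_eq_zero_left hqk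
  have h2k : (2 : k) ≠ 0 := by
    intro h
    simp [h] at h2mk
  have e1 : (q - 1) / 2 = m := by omega
  have e2 : (q + 1) / 2 = m + 1 := by omega
  rw [e1] at hξ ⊢
  rw [e2] at hty
  obtain ⟨a, ha⟩ := IsAlgClosed.exists_pow_nat_eq ξ two_pos
  have ha0 : a ≠ 0 := by
    rintro rfl
    rw [zero_pow two_ne_zero] at ha
    rw [← ha, zero_pow hm0] at hξ
    exact zero_ne_one hξ
  have haq : a ^ q = a := by
    rw [hqm, pow_succ, pow_mul, ha, hξ, one_mul]
  set b := algebraMap k F' a with hb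
  have hbξ : algebraMap k F' ξ = b ^ 2 := by rw [← ha, map_pow]
  have hbq : b ^ q = b := by rw [hb, ← map_pow, haq]
  have h2b : 2 * b ≠ 0 := by
    rw [hb, ← map_ofNat (algebraMap k F') 2, ← map_mul, _root_.map_ne_zero]
    exact mul_ne_zero h2k ha0
  have htm : t ^ m - 1 ≠ 0 := fun h0 =>
    ht.pow hm0.bot_lt (by rw [sub_eq_zero.1 h0]; exact isAlgebraic_one)
  -- `t` is the square of `x`
  set x := y ^ (m + 1) / (t ^ m - 1) with hx
  have hxt : x ^ 2 = t := by
    rw [hx, div_pow, ← pow_mul, show (m + 1) * 2 = q + 1 by omega, hty,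
      div_eq_iff (pow_ne_zero 2 htm), hqm]
    ring
  have hxy : y ^ (m + 1) = x ^ q - x := by
    rw [hqm, pow_succ x, pow_mul, hxt, hx]
    field_simp
  clear_value x
  have hxtr : Transcendental k x := fun h => ht (hxt ▸ h.pow 2)
  have hxa (d : k) : x - algebraMap k F' d ≠ 0 := fun h =>
    hxtr (sub_eq_zero.1 h ▸ isAlgebraic_algebraMap d)
  have hxb : x - b ≠ 0 := hxa a
  have hxb' : x + b ≠ 0 := by simpa [hb] using hxa (-a)
  have htξ : t - algebraMap k F' ξ = (x - b) * (x + b) := by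
    rw [hbξ, ← hxt]
    ring
  rw [htξ] at hu
  have hyu : y = u * ((x - b) * (x + b)) := by
    rw [hu]
    field_simp
  set w := (x - b) / (x + b) with hw
  have hw1 : 1 - w = 2 * b / (x + b) := by
    rw [hw]
    field_simp
    ring
  have hw1' : 1 - w ≠ 0 := hw1 ▸ div_ne_zero h2b hxb'
  have hxw : x = b * (1 + w) / (1 - w) := by
    rw [eq_div_iff hw1', hw]
    field_simp
    ring
  have hmemx {S : IntermediateField k F'} (hS : w ∈ S) : x ∈ S := by
    rw [hxw]
    exact S.div_mem (S.mul_mem (S.algebraMap_mem a) (S.add_mem S.one_mem hS))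
      (S.sub_mem S.one_mem hS)
  have : CharP F' p := charP_of_injective_algebraMap (algebraMap k F').injective p
  have hfrob : (x - b) ^ q = x ^ q - b := by
    rw [hq, sub_pow_char_pow, ← hq, hbq]
  have hfrob' : (x + b) ^ q = x ^ q + b := by
    rw [hq, add_pow_char_pow, ← hq, hbq]
  have hmain : w ^ (2 * m) - 1 = algebraMap k F' (2 * a) * u ^ (m + 1) * w ^ m := by
    rw [map_mul, map_ofNat, ← hb, hw, hu, div_pow, div_pow, div_pow, hxy]
    have hne : (x - b) ^ m ≠ 0 := pow_ne_zero m hxb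
    have hne' : (x + b) ^ m ≠ 0 := pow_ne_zero m hxb'
    generalize x ^ q = z at hfrob hfrob' ⊢
    rw [hqm, pow_succ, pow_mul'] at hfrob hfrob'
    rw [mul_pow, pow_mul', pow_mul', pow_succ _ m, pow_succ _ m]
    generalize (x - b) ^ m = P at hfrob hne ⊢
    generalize (x + b) ^ m = Q at hfrob' hne' ⊢
    field_simp
    linear_combination (x + b) * hfrob - (x - b) * hfrob'
  refine isGalois_dihedral_of_pow_sub_one_eq (by rw [h2mk]; exact neg_ne_zero.2 one_ne_zero)
    m.succ_ne_zero (mul_ne_zero h2k ha0) ?_ hmain ?_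
  · intro hwalg
    have hmem : w ∈ algebraicClosure k F' := mem_algebraicClosure_iff.2 hwalg
    exact hxtr (mem_algebraicClosure_iff.1 (hmemx hmem))
  · rw [eq_top_iff, ← hgen, adjoin_le_iff]
    have hxmem : x ∈ adjoin k {u, w} := hmemx (subset_adjoin _ _ (by simp))
    have hbmem : b ∈ adjoin k {u, w} := _root_.algebraMap_mem _ a
    have humem : u ∈ adjoin k {u, w} := subset_adjoin _ _ (by simp)
    rintro z (rfl | rfl)
    · rw [SetLike.mem_coe, ← hxt]
      exact pow_mem hxmem 2
    · rw [SetLike.mem_coe, hyu]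
      exact mul_mem humem (mul_mem (sub_mem hxmem hbmem) (add_mem hxmem hbmem))
end

section
/- Let α, β ∈ k satisfy α^(q²) = α, α^q ≠ α, β^(q²) = β, β^q ≠ β, with β ≠ α and β ≠ α^q. Then the subfield of F generated by k together with the two elements (x − α)²/y and (x − β)²/y is all of F; equivalently, the compositum of the Galois subfields k⟮(x − α)²/y⟯ and k⟮(x − β)²/y⟯ equals F. -/
open IntermediateField Polynomial

/-- `B * (t ^ 2) ^ j + C` does not vanish at a transcendental `t` when `0 < j` and `C ≠ 0`. -/
theorem mul_sq_pow_add_ne_zero {k F : Type*} [Field k] [Field F] [Algebra k F] {t : F}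
    (ht : Transcendental k t) (B : k) {C : k} (hC : C ≠ 0) {j : ℕ} (hj : j ≠ 0) :
    algebraMap k F B * (t ^ 2) ^ j + algebraMap k F C ≠ 0 := by
  intro h
  refine ht ⟨Polynomial.C B * (X ^ 2) ^ j + Polynomial.C C, fun h0 => hC ?_, by simpa using h⟩
  simpa [hj] using congrArg (Polynomial.eval 0) h0

/-- With `a = x - α` and `b = x - β`, this expresses `x ^ q - x` as a form in `a` and `b`. -/
theorem pow_char_sub_self_eq {F : Type*} [Field F] (p : ℕ) [Fact p.Prime] [CharP F p]
    (n : ℕ) (x α β : F) :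
    (β - α) ^ (p ^ n + 1) * (x ^ p ^ n - x) =
      (β ^ p ^ n - β) * (x - α) ^ (p ^ n + 1) + (α - β ^ p ^ n) * (x - α) ^ p ^ n * (x - β)
        + (β - α ^ p ^ n) * (x - α) * (x - β) ^ p ^ n
        + (α ^ p ^ n - α) * (x - β) ^ (p ^ n + 1) := by
  simp only [pow_succ _ (p ^ n), sub_pow_char_pow]
  ring

/-- Let `α, β ∈ 𝔽_{q²} \ 𝔽_q` inside `k` with `β ≠ α` and `β ≠ α^q`.
Then the subfield of `F` generated by `k`, `(x - α)²/y` and `(x - β)²/y` is all of `F`;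
equivalently, the compositum of `k⟮(x - α)²/y⟯` and `k⟮(x - β)²/y⟯` equals `F`. -/
theorem stmt_18
    (k : Type*) [Field k] [IsAlgClosed k]
    (p : ℕ) [Fact p.Prime] (hp2 : p ≠ 2) [CharP k p]
    (n q : ℕ) (hq : q = p ^ n) (hq5 : 5 ≤ q)
    (F : Type*) [Field F] [Algebra k F]
    (x y : F) (hx : Transcendental k x)
    (hxy : y ^ ((q + 1) / 2) = x ^ q - x)
    (hgen : adjoin k {x, y} = ⊤)
    (α β : k) (hα : α ^ q ^ 2 = α) (hα' : α ^ q ≠ α)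
    (hβ : β ^ q ^ 2 = β) (hβ' : β ^ q ≠ β)
    (hαβ : β ≠ α) (hαβq : β ≠ α ^ q)
    (u v : F) (hu : u = (x - algebraMap k F α) ^ 2 / y)
    (hv : v = (x - algebraMap k F β) ^ 2 / y) :
    adjoin k {u, v} = ⊤ ∧ k⟮u⟯ ⊔ k⟮v⟯ = ⊤ := by
  have key : adjoin k {u, v} = ⊤ := by
    set K := adjoin k {u, v}
    have huK : u ∈ K := subset_adjoin _ _ (by simp)
    have hvK : v ∈ K := subset_adjoin _ _ (by simp)
    have hc : ∀ c : k, algebraMap k F c ∈ K := K.algebraMap_mem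
    have hxc : ∀ c : k, x - algebraMap k F c ≠ 0 := fun c h =>
      hx (sub_eq_zero.mp h ▸ isAlgebraic_algebraMap c)
    have : CharP F p := charP_of_injective_algebraMap (algebraMap k F).injective p
    obtain ⟨j, hj⟩ : Odd q := hq ▸ ((Fact.out : p.Prime).odd_of_ne_two hp2).pow
    have hxq : x ^ q - x ≠ 0 := fun h =>
      hx ⟨X ^ q - X, FiniteField.X_pow_card_sub_X_ne_zero k (by omega), by simpa using h⟩
    rw [show (q + 1) / 2 = j + 1 by omega] at hxy
    have hy : y ≠ 0 := by
      rintro rfl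
      exact hxq (by rw [← hxy]; simp)
    have ha := hxc α
    have hb := hxc β
    have hform := pow_char_sub_self_eq p n x (algebraMap k F α) (algebraMap k F β)
    rw [← hq, ← hxy] at hform
    set a := x - algebraMap k F α with ha_def
    set b := x - algebraMap k F β with hb_def
    have hd : algebraMap k F (β - α) ≠ 0 := by simpa [sub_eq_zero] using hαβ
    have hab : a - b = algebraMap k F (β - α) := by simp [ha_def, hb_def]
    obtain ⟨t, ht⟩ : ∃ t, t = a / b := ⟨_, rfl⟩
    have hat : a = t * b := by rw [ht]; field_simp
    have ht1 : t - 1 ≠ 0 := fun h => hd (by rw [← hab, hat]; linear_combination b * h)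
    have hxt : x = algebraMap k F β + algebraMap k F (β - α) / (t - 1) := by
      rw [← hab, hat, show t * b - b = b * (t - 1) by ring, mul_div_cancel_right₀ _ ht1, hb_def]
      ring
    have htr : Transcendental k t := fun h => hx <| by
      rw [hxt, div_eq_mul_inv]
      exact (isAlgebraic_algebraMap β).add ((isAlgebraic_algebraMap _).mul
        (h.sub isAlgebraic_one).inv)
    have hs : t ^ 2 ∈ K := by
      have : t ^ 2 = u / v := by rw [hu, hv, ht]; field_simp
      exact this ▸ div_mem huK hvK
    have hw := mul_sq_pow_add_ne_zero htr (α - β ^ q) (sub_ne_zero.mpr hαβq)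
      (show j ≠ 0 by omega)
    have hteq : t = (algebraMap k F (β - α) ^ (q + 1) / v ^ (j + 1)
        - algebraMap k F (β ^ q - β) * (t ^ 2) ^ (j + 1) - algebraMap k F (α ^ q - α)) /
        (algebraMap k F (α - β ^ q) * (t ^ 2) ^ j + algebraMap k F (β - α ^ q)) := by
      rw [eq_div_iff hw, hv, div_pow, div_div_eq_mul_div]
      have hbp : (b ^ 2) ^ (j + 1) ≠ 0 := by positivity
      have : algebraMap k F (β - α) ^ (q + 1) * y ^ (j + 1) / (b ^ 2) ^ (j + 1) =
          algebraMap k F (β ^ q - β) * (t ^ 2) ^ (j + 1)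
          + t * (algebraMap k F (α - β ^ q) * (t ^ 2) ^ j + algebraMap k F (β - α ^ q))
          + algebraMap k F (α ^ q - α) := by
        rw [div_eq_iff hbp]
        simp only [map_sub, map_pow]
        rw [hform, hat, hj]
        ring_nf
      rw [this]
      ring
    have htK : t ∈ K := by
      rw [hteq]
      exact div_mem (sub_mem (sub_mem (div_mem (pow_mem (hc _) _) (pow_mem hvK _))
        (mul_mem (hc _) (pow_mem hs _))) (hc _)) (add_mem (mul_mem (hc _) (pow_mem hs _)) (hc _))
    have hxK : x ∈ K := by
      rw [hxt]
      exact add_mem (hc _) (div_mem (hc _) (sub_mem htK (one_mem _)))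
    have hyK : y ∈ K := by
      have : y = a ^ 2 / u := by rw [hu]; field_simp
      rw [this]
      exact div_mem (pow_mem (sub_mem hxK (hc _)) _) huK
    rw [eq_top_iff, ← hgen, adjoin_le_iff]
    rintro z (rfl | rfl)
    exacts [hxK, hyK]
  refine ⟨key, ?_⟩
  rw [← adjoin_union, Set.singleton_union, key]
end
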